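/- Let (L, h, (·,·)) be an extended affine Lie superalgebra over a field F of characteristic zero with root system R, and let A be the additive subgroup of h* generated by R, equipped with the symmetric form (α,β) := (t_α, t_β). Then (A, (·,·), R) is an extended affine root supersystem; that is: (S1) 0 ∈ R and R generates A; (S2) R = -R; (S3) for all α ∈ R with (α,α) ≠ 0 and all β ∈ R, 2(α,β)/(α,α) = n·1_F for some integer n; (S4) for all α ∈ R with (α,α) ≠ 0 and all β ∈ R, there exist nonnegative integers p, q with 2(β,α)/(α,α) = (p-q)·1_F and {k ∈ ℤ : β + kα ∈ R} = {-p, …, q}; (S5) for all α, β ∈ R with (α,α) = 0 and (α,β) ≠ 0, β - α ∈ R or β + α ∈ R. -/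

import Mathlib

/-- A Lie superalgebra over `F`: a `ℤ/2`-graded vector space with a bilinear bracket
satisfying super skew-symmetry and the super Jacobi identity on homogeneous elements. -/
structure LieSuperAlgebra (F : Type) [Field F] (L : Type) [AddCommGroup L] [Module F L] where
  bracket : L →ₗ[F] L →ₗ[F] L
  carrier : ZMod 2 → Submodule F L
  isCompl : IsCompl (carrier 0) (carrier 1)
  bracket_mem : ∀ i j : ZMod 2, ∀ x ∈ carrier i, ∀ y ∈ carrier j, bracket x y ∈ carrier (i + j)
  skew : ∀ i j : ZMod 2, ∀ x ∈ carrier i, ∀ y ∈ carrier j,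
    bracket x y = -(((-1 : F) ^ (i.val * j.val)) • bracket y x)
  super_jacobi : ∀ i j : ZMod 2, ∀ x ∈ carrier i, ∀ y ∈ carrier j, ∀ z : L,
    bracket (bracket x y) z
      = bracket x (bracket y z) - ((-1 : F) ^ (i.val * j.val)) • bracket y (bracket x z)

/-- A super-toral triple `(L, H, (·,·))`: a nonzero Lie superalgebra with a nontrivial
abelian subalgebra `H` of the even part, a nondegenerate invariant even supersymmetric
bilinear form whose restriction to `H` is nondegenerate, and a weight space decomposition
of `L` with respect to `H`. -/
structure SuperToral (F : Type) [Field F] (L : Type) [AddCommGroup L] [Module F L]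
    extends LieSuperAlgebra F L where
  L_ne : ∃ x : L, x ≠ 0
  H : Submodule F L
  H_le : H ≤ carrier 0
  H_ne_bot : H ≠ ⊥
  H_sub : ∀ x ∈ H, ∀ y ∈ H, bracket x y ∈ H
  form : L →ₗ[F] L →ₗ[F] F
  form_nondeg : ∀ x : L, (∀ y : L, form x y = 0) → x = 0
  form_inv : ∀ x y z : L, form (bracket x y) z = form x (bracket y z)
  form_even : ∀ x ∈ carrier 0, ∀ y ∈ carrier 1, form x y = 0
  form_super : ∀ i j : ZMod 2, ∀ x ∈ carrier i, ∀ y ∈ carrier j,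
    form x y = ((-1 : F) ^ (i.val * j.val)) * form y x
  /-- The weight space attached to a linear functional on `H`. -/
  wt : Module.Dual F ↥H → Submodule F L
  wt_def : ∀ (α : Module.Dual F ↥H) (x : L), x ∈ wt α ↔ ∀ t : ↥H, bracket ↑t x = α t • x
  /-- The weight spaces are independent … -/
  wt_indep : iSupIndep wt
  /-- … and they span `L`, i.e. `L = ⊕_α L^α`. -/
  wt_sup : (⨆ α : Module.Dual F ↥H, wt α) = ⊤
  form_H_nondeg : ∀ t : ↥H, (∀ s : ↥H, form ↑t ↑s = 0) → t = 0

/-- An extended affine Lie superalgebra: a super-toral triple such that (1) every nonzero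
root space pair `(α, -α)` of fixed parity contains elements whose bracket is a nonzero
element of `H`, and (2) for every root `α` with `(α,α) ≠ 0` (expressed via a representative
`t_α ∈ H` of `α` through the form), `ad x` is locally nilpotent for `x ∈ L^α`. -/
structure EALS (F : Type) [Field F] (L : Type) [AddCommGroup L] [Module F L]
    extends SuperToral F L where
  ax1 : ∀ i : ZMod 2, ∀ α : Module.Dual F ↥H, α ≠ 0 → carrier i ⊓ wt α ≠ ⊥ →
    ∃ x ∈ carrier i ⊓ wt α, ∃ y ∈ carrier i ⊓ wt (-α),
      bracket x y ∈ H ∧ bracket x y ≠ 0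
  ax2 : ∀ α : Module.Dual F ↥H, wt α ≠ ⊥ →
    ∀ t : ↥H, (∀ s : ↥H, form ↑t ↑s = α s) → form ↑t ↑t ≠ 0 →
    ∀ x ∈ wt α, ∀ y : L, ∃ n : ℕ, ((bracket x) ^ n) y = 0

/-- Integer parameters `k` for which `b + n k + k²` vanishes or divides `n + 2 k` are bounded. -/
theorem exists_bound_of_quadratic_dvd {F : Type*} [Field F] [CharZero F] (b : F) (n : ℤ) :
    ∃ K : ℤ, ∀ k : ℤ, (b + n * k + k ^ 2 = 0 ∨
      ∃ m : ℤ, (n + 2 * k : F) = m * (b + n * k + k ^ 2)) → |k| ≤ K := by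
  by_cases hex : ∃ k : ℤ, n + 2 * k ≠ 0 ∧ (b + n * k + k ^ 2 = 0 ∨
      ∃ m : ℤ, (n + 2 * k : F) = m * (b + n * k + k ^ 2))
  · obtain ⟨d, r, hd, hr⟩ : ∃ d r : ℤ, d ≠ 0 ∧ (d : F) * b = r := by
      obtain ⟨k, hk, h | ⟨m, h⟩⟩ := hex
      · refine ⟨1, -(n * k + k ^ 2), one_ne_zero, ?_⟩
        push_cast
        linear_combination h
      · refine ⟨m, n + 2 * k - m * (n * k + k ^ 2), ?_, ?_⟩
        · rintro rfl
          apply hk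
          have : ((n + 2 * k : ℤ) : F) = 0 := by push_cast; rw [h]; simp
          exact_mod_cast this
        · push_cast
          linear_combination -h
    refine ⟨2 * |n| + |r| + 3, fun k hk => ?_⟩
    have hn := neg_abs_le n
    have hn' := le_abs_self n
    have hk1 := neg_abs_le k
    have hk2 := le_abs_self k
    have hr0 := abs_nonneg r
    by_cases h0 : n + 2 * k = 0
    · rw [abs_le]; constructor <;> linarith [abs_nonneg n]
    have key : |r + d * (n * k + k ^ 2)| ≤ |d| * |n + 2 * k| := by
      rcases hk with h | ⟨m, h⟩
      · have : ((r + d * (n * k + k ^ 2) : ℤ) : F) = 0 := by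
          push_cast; linear_combination (d : F) * h - hr
        rw [Int.cast_eq_zero.mp this, abs_zero]
        positivity
      · have e : d * (n + 2 * k) = m * (r + d * (n * k + k ^ 2)) := by
          have : ((d * (n + 2 * k) : ℤ) : F) = ((m * (r + d * (n * k + k ^ 2)) : ℤ) : F) := by
            push_cast; linear_combination (d : F) * h + (m : F) * hr
          exact_mod_cast this
        have hm : m ≠ 0 := by
          rintro rfl
          simp [hd, h0] at e
        rw [← abs_mul, e, abs_mul]
        exact le_mul_of_one_le_left (abs_nonneg _) (Int.one_le_abs hm)
    have hd1 : 1 ≤ |d| := Int.one_le_abs hd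
    have h1 : |d| * |n * k + k ^ 2| ≤ |d| * (|n + 2 * k| + |r|) := by
      have h2 : |d * (n * k + k ^ 2)| ≤ |r + d * (n * k + k ^ 2)| + |r| := by
        have := abs_sub (r + d * (n * k + k ^ 2)) r
        simpa using this
      rw [abs_mul] at h2
      nlinarith
    have h3 : |n * k + k ^ 2| ≤ |n + 2 * k| + |r| := le_of_mul_le_mul_left h1 (by linarith)
    have h4 : |n + 2 * k| ≤ |n| + 2 * |k| := by
      have := abs_add_le n (2 * k)
      rwa [abs_mul, abs_two] at this
    have h5 : |k| * (|k| - |n|) ≤ |n * k + k ^ 2| := by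
      rw [show n * k + k ^ 2 = k * (k - -n) by ring, abs_mul]
      have := abs_sub_abs_le_abs_sub k (-n)
      rw [abs_neg] at this
      exact mul_le_mul_of_nonneg_left this (abs_nonneg k)
    by_contra! hlt
    nlinarith [abs_nonneg n, abs_nonneg k]
  · push Not at hex
    refine ⟨|n|, fun k hk => ?_⟩
    have h0 : n + 2 * k = 0 := by
      by_contra h
      obtain ⟨h1, h2⟩ := hex k h
      rcases hk with h | ⟨m, h⟩
      · exact h1 h
      · exact h2 m h
    rw [abs_le]
    constructor <;> linarith [neg_abs_le n, le_abs_self n, abs_nonneg n]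

/-- Action of a raising operator on the lowering chain of a vector it kills, when the operators
satisfy `XY - YX = h`. -/
theorem raise_lower_pow_of_commutator {F M : Type*} [Field F] [AddCommGroup M] [Module F M]
    (X Y : Module.End F M) (v : M) (μ a : F) (hX : X v = 0)
    (h : ∀ j : ℕ, X (Y ((Y ^ j) v)) - Y (X ((Y ^ j) v)) = (μ - j * a) • (Y ^ j) v) (j : ℕ) :
    (2 : F) • X ((Y ^ (j + 1)) v) = ((j + 1) * (2 * μ - j * a)) • (Y ^ j) v := by
  induction j with
  | zero =>
    have := h 0
    simp only [pow_zero, Module.End.one_apply, hX, map_zero, sub_zero] at this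
    simp [this, smul_smul]
  | succ j ih =>
    have e := sub_eq_iff_eq_add.mp (h (j + 1))
    rw [pow_succ' Y (j + 1), Module.End.mul_apply, e, smul_add, ← map_smul Y, ih, map_smul,
      ← Module.End.mul_apply Y, ← pow_succ', smul_smul, ← add_smul]
    congr 1
    push_cast
    ring

/-- Action of a raising operator on the lowering chain of a vector it kills, when the operators
satisfy `XY + YX = h`. -/
theorem raise_lower_pow_of_anticommutator {F M : Type*} [Field F] [AddCommGroup M] [Module F M]
    (X Y : Module.End F M) (v : M) (μ a : F) (hX : X v = 0)
    (h : ∀ j : ℕ, X (Y ((Y ^ j) v)) + Y (X ((Y ^ j) v)) = (μ - j * a) • (Y ^ j) v) (j : ℕ) :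
    X ((Y ^ (2 * j + 1)) v) = (μ - j * a) • (Y ^ (2 * j)) v ∧
      X ((Y ^ (2 * j + 2)) v) = (-(j + 1) * a) • (Y ^ (2 * j + 1)) v := by
  have step : ∀ (m : ℕ) (c : F), X ((Y ^ (m + 1)) v) = c • (Y ^ m) v →
      X ((Y ^ (m + 2)) v) = (μ - (m + 1) * a - c) • (Y ^ (m + 1)) v := by
    intro m c hc
    have e := eq_sub_of_add_eq (h (m + 1))
    rw [pow_succ' Y (m + 1), Module.End.mul_apply, e, hc, map_smul, ← Module.End.mul_apply Y,
      ← pow_succ', ← sub_smul]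
    push_cast
    rfl
  have odd_of_even : ∀ j : ℕ, X ((Y ^ (2 * j + 1)) v) = (μ - j * a) • (Y ^ (2 * j)) v →
      X ((Y ^ (2 * j + 2)) v) = (-(j + 1) * a) • (Y ^ (2 * j + 1)) v := by
    intro j hj
    rw [step _ _ hj]
    congr 1
    push_cast
    ring
  suffices hs : X ((Y ^ (2 * j + 1)) v) = (μ - j * a) • (Y ^ (2 * j)) v from ⟨hs, odd_of_even j hs⟩
  induction j with
  | zero =>
    have := h 0
    simpa [hX] using this
  | succ j ih =>
    rw [show 2 * (j + 1) + 1 = 2 * j + 1 + 2 by ring, step _ _ (odd_of_even j ih)]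
    rw [show 2 * (j + 1) = 2 * j + 1 + 1 by ring]
    congr 1
    push_cast
    ring

/-- The weight of a highest weight vector whose lowering chain has length `j`. -/
theorem two_mul_weight_eq_of_lowering_chain {F M : Type*} [Field F] [CharZero F]
    [AddCommGroup M] [Module F M] (X Y : Module.End F M) (v : M) (ε μ a : F)
    (hε : ε = 1 ∨ ε = -1) (ha : a ≠ 0) (hX : X v = 0)
    (h : ∀ j : ℕ, X (Y ((Y ^ j) v)) - ε • Y (X ((Y ^ j) v)) = (μ - j * a) • (Y ^ j) v)
    (j : ℕ) (hj : (Y ^ j) v ≠ 0) (hj' : (Y ^ (j + 1)) v = 0) : 2 * μ = j * a := by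
  rcases hε with rfl | rfl
  · simp only [one_smul] at h
    have e := raise_lower_pow_of_commutator X Y v μ a hX h j
    rw [hj', map_zero, smul_zero, eq_comm, smul_eq_zero_iff_left hj] at e
    exact sub_eq_zero.mp ((mul_eq_zero.mp e).resolve_left (Nat.cast_add_one_ne_zero j))
  · simp only [neg_smul, one_smul, sub_neg_eq_add] at h
    have e := raise_lower_pow_of_anticommutator X Y v μ a hX h
    obtain ⟨m, rfl | rfl⟩ := Nat.even_or_odd' j
    · have := (e m).1
      rw [hj', map_zero, eq_comm, smul_eq_zero_iff_left hj] at this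
      push_cast
      linear_combination 2 * this
    · have := (e m).2
      rw [hj', map_zero, eq_comm, smul_eq_zero_iff_left hj] at this
      exact absurd this (mul_ne_zero (neg_ne_zero.mpr (Nat.cast_add_one_ne_zero m)) ha)

namespace SuperToral

variable {F : Type} [Field F] {L : Type} [AddCommGroup L] [Module F L] (E : SuperToral F L)

theorem exists_parity_decomposition (x : L) :
    ∃ y ∈ E.carrier 0, ∃ z ∈ E.carrier 1, y + z = x :=
  Submodule.mem_sup.mp (E.isCompl.sup_eq_top ▸ Submodule.mem_top)

theorem bracket_H_right (t : E.H) (x : L) : E.bracket x t = -E.bracket t x := by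
  obtain ⟨y, hy, z, hz, rfl⟩ := E.exists_parity_decomposition x
  have h0 := E.skew 0 0 y hy t (E.H_le t.2)
  have h1 := E.skew 1 0 z hz t (E.H_le t.2)
  simp only [ZMod.val_zero, mul_zero, pow_zero, one_smul] at h0 h1
  rw [map_add, LinearMap.add_apply, map_add, h0, h1]
  abel

theorem bracket_H_left_form (t : E.H) (x y : L) :
    E.form (E.bracket t x) y = -E.form x (E.bracket t y) := by
  rw [← neg_neg (E.bracket t x), ← E.bracket_H_right, map_neg, LinearMap.neg_apply, E.form_inv]

theorem form_eq_zero_of_forall_wt {x : L} (h : ∀ γ, ∀ z ∈ E.wt γ, E.form x z = 0) : x = 0 := by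
  refine E.form_nondeg x fun y => ?_
  have hy : y ∈ ⨆ γ, E.wt γ := E.wt_sup ▸ Submodule.mem_top
  induction hy using Submodule.iSup_induction' with
  | mem γ z hz => exact h γ z hz
  | zero => exact map_zero _
  | add y z _ _ hy hz => rw [map_add, hy, hz, add_zero]

theorem form_wt_eq_zero {α β : Module.Dual F E.H} (hαβ : β ≠ -α) {x y : L}
    (hx : x ∈ E.wt α) (hy : y ∈ E.wt β) : E.form x y = 0 := by
  by_contra hne
  apply hαβ
  ext t
  have h := E.bracket_H_left_form t x y
  rw [(E.wt_def α x).mp hx, (E.wt_def β y).mp hy, map_smul, map_smul, LinearMap.smul_apply,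
    smul_eq_mul, smul_eq_mul] at h
  have : (β t + α t) * E.form x y = 0 := by linear_combination h
  exact eq_neg_of_add_eq_zero_left ((mul_eq_zero.mp this).resolve_right hne)

theorem wt_neg_ne_bot {α : Module.Dual F E.H} (h : E.wt α ≠ ⊥) : E.wt (-α) ≠ ⊥ := by
  obtain ⟨x, hx, hx0⟩ := Submodule.exists_mem_ne_zero_of_ne_bot h
  intro hbot
  refine hx0 (E.form_eq_zero_of_forall_wt fun γ z hz => ?_)
  by_cases hγ : γ = -α
  · rw [hγ, hbot, Submodule.mem_bot] at hz
    rw [hz, map_zero]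
  · exact E.form_wt_eq_zero hγ hx hz

theorem exists_parity_inf_wt_ne_bot {α : Module.Dual F E.H} (h : E.wt α ≠ ⊥) :
    ∃ i, E.carrier i ⊓ E.wt α ≠ ⊥ := by
  obtain ⟨x, hx, hx0⟩ := Submodule.exists_mem_ne_zero_of_ne_bot h
  obtain ⟨y, hy, z, hz, rfl⟩ := E.exists_parity_decomposition x
  have key : ∀ t : E.H, E.bracket t y - α t • y = 0 ∧ E.bracket t z - α t • z = 0 := by
    intro t
    have hty : E.bracket t y - α t • y ∈ E.carrier 0 :=
      sub_mem (by simpa using E.bracket_mem 0 0 t (E.H_le t.2) y hy) (Submodule.smul_mem _ _ hy)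
    have htz : E.bracket t z - α t • z ∈ E.carrier 1 :=
      sub_mem (by simpa using E.bracket_mem 0 1 t (E.H_le t.2) z hz) (Submodule.smul_mem _ _ hz)
    have hsum : E.bracket t y - α t • y = -(E.bracket t z - α t • z) := by
      have := (E.wt_def α _).mp hx t
      rw [map_add, smul_add] at this
      rw [eq_neg_iff_add_eq_zero, sub_add_sub_comm, this, sub_self]
    have h0 : E.bracket t y - α t • y = 0 :=
      Submodule.disjoint_def.mp E.isCompl.disjoint _ hty (hsum ▸ neg_mem htz)
    exact ⟨h0, by rwa [h0, eq_comm, neg_eq_zero] at hsum⟩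
  have hy' : y ∈ E.wt α := (E.wt_def α y).mpr fun t => sub_eq_zero.mp (key t).1
  have hz' : z ∈ E.wt α := (E.wt_def α z).mpr fun t => sub_eq_zero.mp (key t).2
  by_cases hy0 : y = 0
  · refine ⟨1, Submodule.ne_bot_iff _ |>.mpr ⟨z, ⟨hz, hz'⟩, ?_⟩⟩
    rintro rfl
    simp [hy0] at hx0
  · exact ⟨0, Submodule.ne_bot_iff _ |>.mpr ⟨y, ⟨hy, hy'⟩, hy0⟩⟩

theorem bracket_mem_wt {i : ZMod 2} {α β : Module.Dual F E.H} {x y : L}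
    (hx : x ∈ E.carrier i ⊓ E.wt α) (hy : y ∈ E.wt β) : E.bracket x y ∈ E.wt (α + β) := by
  rw [E.wt_def]
  intro t
  have h := E.super_jacobi 0 i t (E.H_le t.2) x hx.1 y
  rw [(E.wt_def α x).mp hx.2, (E.wt_def β y).mp hy] at h
  simp only [ZMod.val_zero, zero_mul, pow_zero, one_smul, map_smul, LinearMap.smul_apply] at h
  rw [LinearMap.add_apply, add_smul, h]
  abel

theorem bracket_pow_mem_wt {i : ZMod 2} {α β : Module.Dual F E.H} {x y : L}
    (hx : x ∈ E.carrier i ⊓ E.wt α) (hy : y ∈ E.wt β) (n : ℕ) :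
    (E.bracket x ^ n) y ∈ E.wt (β + n • α) := by
  induction n with
  | zero => simpa using hy
  | succ n ih =>
    rw [pow_succ', Module.End.mul_apply, succ_nsmul, ← add_assoc, add_comm]
    exact E.bracket_mem_wt hx ih

theorem bracket_eq_form_smul {α : Module.Dual F E.H} {t : E.H}
    (ht : ∀ s : E.H, E.form t s = α s) {x y : L} (hy : y ∈ E.wt (-α)) (h : E.bracket x y ∈ E.H) :
    E.bracket x y = E.form x y • (t : L) := by
  have : (⟨E.bracket x y, h⟩ - E.form x y • t : E.H) = 0 := by
    refine E.form_H_nondeg _ fun s => ?_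
    simp only [AddSubgroupClass.coe_sub, Submodule.coe_smul, map_sub, map_smul,
      LinearMap.sub_apply, LinearMap.smul_apply, smul_eq_mul]
    rw [E.form_inv, E.bracket_H_right, (E.wt_def _ y).mp hy, ht]
    simp [mul_comm]
  exact congrArg Subtype.val (sub_eq_zero.mp this)

variable [CharZero F]

theorem bracket_H_H (s t : E.H) : E.bracket s t = 0 := by
  have : IsAddTorsionFree L := .of_isTorsionFree F L
  have self : ∀ t : E.H, E.bracket t t = 0 := fun t => self_eq_neg.mp (E.bracket_H_right t t)
  have aux : ∀ (t : E.H) (γ : Module.Dual F E.H), ∀ z ∈ E.wt γ, γ t * E.form t z = 0 := by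
    intro t γ z hz
    rw [← smul_eq_mul, ← map_smul, ← (E.wt_def γ z).mp hz, ← E.form_inv, self, map_zero,
      LinearMap.zero_apply]
  refine E.form_eq_zero_of_forall_wt fun γ z hz => ?_
  have h1 : E.form (E.bracket s t) z = γ t * E.form s z := by
    rw [E.form_inv, (E.wt_def γ z).mp hz, map_smul, smul_eq_mul]
  have h2 : E.form (E.bracket s t) z = -(γ s * E.form t z) := by
    rw [E.bracket_H_left_form, (E.wt_def γ z).mp hz, map_smul, smul_eq_mul]
  rcases mul_eq_zero.mp (aux s γ z hz) with h | h
  · rw [h2, h, zero_mul, neg_zero]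
  · rw [h1, h, mul_zero]

theorem wt_zero_ne_bot : E.wt 0 ≠ ⊥ := by
  obtain ⟨t, ht, ht0⟩ := Submodule.exists_mem_ne_zero_of_ne_bot E.H_ne_bot
  refine Submodule.ne_bot_iff _ |>.mpr ⟨t, (E.wt_def 0 t).mpr fun s => ?_, ht0⟩
  rw [LinearMap.zero_apply, zero_smul]
  exact E.bracket_H_H s ⟨t, ht⟩

end SuperToral

namespace EALS

variable {F : Type} [Field F] {L : Type} [AddCommGroup L] [Module F L] (E : EALS F L)

/-- A nonzero root has opposite root vectors `x`, `y` acting on each weight space by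
`xy ∓ yx = c (α, ·)` with `c ≠ 0`. -/
theorem exists_root_vectors {α : Module.Dual F E.H} (hα : E.wt α ≠ ⊥) (hα0 : α ≠ 0) {t : E.H}
    (ht : ∀ s : E.H, E.form t s = α s) :
    ∃ (i : ZMod 2) (ε c : F), (ε = 1 ∨ ε = -1) ∧ c ≠ 0 ∧
      ∃ x ∈ E.carrier i ⊓ E.wt α, ∃ y ∈ E.carrier i ⊓ E.wt (-α),
        ∀ γ : Module.Dual F E.H, ∀ z ∈ E.wt γ,
          E.bracket x (E.bracket y z) - ε • E.bracket y (E.bracket x z) = (c * γ t) • z := by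
  obtain ⟨i, hi⟩ := E.exists_parity_inf_wt_ne_bot hα
  obtain ⟨x, hx, y, hy, hH, h0⟩ := E.ax1 i α hα0 hi
  have he := E.bracket_eq_form_smul ht hy.2 hH
  refine ⟨i, _, E.form x y, neg_one_pow_eq_or F (i.val * i.val), ?_, x, hx, y, hy,
    fun γ z hz => ?_⟩
  · intro h
    rw [h, zero_smul] at he
    exact h0 he
  · rw [← E.super_jacobi i i x hx.1 y hy.1, he, map_smul, LinearMap.smul_apply,
      (E.wt_def γ z).mp hz, smul_smul]

/-- Every root space has a nonzero vector in a higher weight space of the `α`-string which is the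
top of a finite `α`-string; `β` itself is that weight when `β + α` is not a root. -/
theorem exists_highest_weight [CharZero F] {α β : Module.Dual F E.H} (hα : E.wt α ≠ ⊥)
    (hβ : E.wt β ≠ ⊥) {t : E.H} (ht : ∀ s : E.H, E.form t s = α s) (hne : α t ≠ 0) :
    ∃ m j : ℕ, 2 * (β + m • α) t = j * α t ∧ (E.wt (β + α) = ⊥ → m = 0) ∧
      ∀ i ≤ j, E.wt (β + m • α + i • -α) ≠ ⊥ := by
  have hα0 : α ≠ 0 := by
    rintro rfl
    exact hne rfl
  obtain ⟨i, ε, c, hε, hc, x, hx, y, hy, hxy⟩ := E.exists_root_vectors hα hα0 ht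
  have hnilx := E.ax2 α hα t ht (by rwa [ht]) x hx.2
  have hnily := E.ax2 (-α) (E.wt_neg_ne_bot hα) (-t) (fun s => by simp [ht])
    (by simpa [ht] using hne) y hy.2
  have last : ∀ (Z : Module.End F L) (v : L), v ≠ 0 → (∃ n : ℕ, (Z ^ n) v = 0) →
      ∃ n : ℕ, (Z ^ n) v ≠ 0 ∧ (Z ^ (n + 1)) v = 0 := by
    classical
    intro Z v hv h
    obtain ⟨n, hn⟩ : ∃ n, Nat.find h = n + 1 := Nat.exists_eq_succ_of_ne_zero fun h0 => by
      have := Nat.find_spec h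
      rw [h0] at this
      exact hv (by simpa using this)
    exact ⟨n, Nat.find_min h (by omega), hn ▸ Nat.find_spec h⟩
  obtain ⟨v, hv, hv0⟩ := Submodule.exists_mem_ne_zero_of_ne_bot hβ
  obtain ⟨m, hm, hm'⟩ := last _ v hv0 (hnilx v)
  rw [pow_succ', Module.End.mul_apply] at hm'
  have hw := E.bracket_pow_mem_wt hx hv m
  set w := (E.bracket x ^ m) v with hwdef
  obtain ⟨j, hj, hj'⟩ := last _ w hm (hnily w)
  refine ⟨m, j, ?_, fun hbot => ?_, fun k hk => ?_⟩
  · have h := two_mul_weight_eq_of_lowering_chain (E.bracket x) (E.bracket y) w ε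
      (c * (β + m • α) t) (c * α t) hε (mul_ne_zero hc hne) hm' (fun k => by
        rw [hxy _ _ (E.bracket_pow_mem_wt hy hw k)]
        congr 1
        simp only [LinearMap.add_apply, LinearMap.smul_apply, LinearMap.neg_apply, nsmul_eq_mul]
        ring) j hj hj'
    exact mul_left_cancel₀ hc (by linear_combination h)
  · by_contra hm0
    have h1 := E.bracket_mem_wt hx hv
    rw [add_comm, hbot, Submodule.mem_bot] at h1
    obtain ⟨l, rfl⟩ := Nat.exists_eq_succ_of_ne_zero hm0
    apply hm
    rw [hwdef, Nat.succ_eq_add_one, pow_succ, Module.End.mul_apply, h1, map_zero]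
  · refine Submodule.ne_bot_iff _ |>.mpr ⟨_, E.bracket_pow_mem_wt hy hw k, fun h0 => hj ?_⟩
    obtain ⟨l, rfl⟩ := Nat.exists_eq_add_of_le' hk
    rw [pow_add, Module.End.mul_apply, h0, map_zero]

theorem exists_int_two_mul_eq [CharZero F] {α β : Module.Dual F E.H} (hα : E.wt α ≠ ⊥)
    (hβ : E.wt β ≠ ⊥) {t : E.H} (ht : ∀ s : E.H, E.form t s = α s) (hne : α t ≠ 0) :
    ∃ n : ℤ, 2 * β t = n * α t := by
  obtain ⟨m, j, h, -⟩ := E.exists_highest_weight hα hβ ht hne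
  refine ⟨j - 2 * m, ?_⟩
  simp only [LinearMap.add_apply, LinearMap.smul_apply, nsmul_eq_mul] at h
  push_cast
  linear_combination h

theorem exists_string_bound [CharZero F] {α β : Module.Dual F E.H} (hα : E.wt α ≠ ⊥)
    (hβ : E.wt β ≠ ⊥) {s t : E.H} (ht : ∀ r : E.H, E.form t r = α r)
    (hs : ∀ r : E.H, E.form s r = β r) (hst : α s = β t) (hne : α t ≠ 0) :
    ∃ K : ℤ, ∀ k : ℤ, E.wt (β + k • α) ≠ ⊥ → |k| ≤ K := by
  obtain ⟨n, hn⟩ := E.exists_int_two_mul_eq hα hβ ht hne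
  obtain ⟨K, hK⟩ := exists_bound_of_quadratic_dvd (β s / α t) n
  refine ⟨K, fun k hk => hK k ?_⟩
  have hnorm : (β + k • α) (s + k • t) = α t * (β s / α t + n * k + k ^ 2) := by
    simp only [LinearMap.add_apply, LinearMap.smul_apply, map_add, map_zsmul, zsmul_eq_mul, hst]
    field_simp
    linear_combination (k : F) * hn
  by_cases h0 : (β + k • α) (s + k • t) = 0
  · rw [hnorm] at h0
    exact Or.inl ((mul_eq_zero.mp h0).resolve_left hne)
  · obtain ⟨m, hm⟩ := E.exists_int_two_mul_eq hk hα (t := s + k • t) (fun r => by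
      simp [hs, ht]) h0
    refine Or.inr ⟨m, mul_left_cancel₀ hne ?_⟩
    rw [hnorm] at hm
    simp only [map_add, map_zsmul, zsmul_eq_mul, hst] at hm
    linear_combination hm - hn

theorem exists_string [CharZero F] {α β : Module.Dual F E.H} (hα : E.wt α ≠ ⊥)
    (hβ : E.wt β ≠ ⊥) {s t : E.H} (ht : ∀ r : E.H, E.form t r = α r)
    (hs : ∀ r : E.H, E.form s r = β r) (hst : α s = β t) (hne : α t ≠ 0) :
    ∃ p q : ℕ, 2 * β t = ((p : F) - q) * α t ∧
      ∀ k : ℤ, E.wt (β + k • α) ≠ ⊥ ↔ -(p : ℤ) ≤ k ∧ k ≤ q := by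
  obtain ⟨K, hK⟩ := E.exists_string_bound hα hβ ht hs hst hne
  have hzero : E.wt (β + (0 : ℤ) • α) ≠ ⊥ := by simpa using hβ
  obtain ⟨q, hq, hqmax⟩ := Int.exists_greatest_of_bdd (P := fun k => E.wt (β + k • α) ≠ ⊥)
    ⟨K, fun k hk => (abs_le.mp (hK k hk)).2⟩ ⟨0, hzero⟩
  obtain ⟨p, hp, hpmin⟩ := Int.exists_least_of_bdd (P := fun k => E.wt (β + k • α) ≠ ⊥)
    ⟨-K, fun k hk => (abs_le.mp (hK k hk)).1⟩ ⟨0, hzero⟩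
  obtain ⟨m, j, hj, hm, hstr⟩ := E.exists_highest_weight hα hq ht hne
  obtain ⟨m', j', hj', hm', hstr'⟩ := E.exists_highest_weight (E.wt_neg_ne_bot hα) hp (t := -t)
    (fun r => by simp [ht]) (by simpa using hne)
  obtain rfl : m = 0 := hm <| by
    by_contra h
    have := hqmax (q + 1) (by rwa [add_smul, one_smul, ← add_assoc])
    omega
  obtain rfl : m' = 0 := hm' <| by
    by_contra h
    have := hpmin (p - 1) (by rwa [sub_smul, one_smul, add_sub, sub_eq_add_neg])
    omega
  have hdown : ∀ i : ℕ, i ≤ j → E.wt (β + (q - i) • α) ≠ ⊥ := fun i hi => by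
    have := hstr i hi
    rwa [zero_smul, add_zero, show β + q • α + i • -α = β + (q - i : ℤ) • α by
      rw [sub_smul, natCast_zsmul, smul_neg, add_assoc, ← sub_eq_add_neg]] at this
  have hup : ∀ i : ℕ, i ≤ j' → E.wt (β + (p + i) • α) ≠ ⊥ := fun i hi => by
    have := hstr' i hi
    rwa [zero_smul, add_zero, neg_neg, show β + p • α + i • α = β + (p + i : ℤ) • α by
      rw [add_smul, natCast_zsmul, add_assoc]] at this
  have h1 := hpmin _ (hdown j le_rfl)
  have h2 := hqmax _ (hup j' le_rfl)
  have hq0 := hqmax 0 hzero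
  have hp0 := hpmin 0 hzero
  simp only [zero_smul, add_zero, LinearMap.add_apply, LinearMap.smul_apply, LinearMap.neg_apply,
    map_neg, neg_neg, zsmul_eq_mul] at hj hj'
  have h3 : (j : ℤ) + j' = 2 * (q - p) := by
    have : ((j + j' : ℤ) : F) = ((2 * (q - p) : ℤ) : F) := by
      push_cast
      exact mul_right_cancel₀ hne (by linear_combination -hj - hj')
    exact_mod_cast this
  have hjq : (j : ℤ) = q - p := by omega
  lift q to ℕ using hq0
  obtain ⟨p, rfl⟩ : ∃ p' : ℕ, p = -p' := ⟨p.natAbs, by omega⟩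
  refine ⟨p, q, ?_, fun k => ⟨fun hk => ⟨hpmin k hk, hqmax k hk⟩, fun hk => ?_⟩⟩
  · have hjF : (j : F) = q + p := by
      have : ((j : ℤ) : F) = ((q - -p : ℤ) : F) := by rw [hjq]
      push_cast at this
      linear_combination this
    rw [hjF] at hj
    push_cast at hj
    linear_combination hj
  · have := hdown (q - k).toNat (by omega)
    rwa [Int.toNat_of_nonneg (by omega), sub_sub_cancel] at this

/-- A root not orthogonal to a nonzero root `α` can be shifted by `α` or by `-α`. -/
theorem wt_sub_or_add_ne_bot {α β : Module.Dual F E.H} (hα : E.wt α ≠ ⊥) (hβ : E.wt β ≠ ⊥)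
    {t : E.H} (ht : ∀ s : E.H, E.form t s = α s) (hne : β t ≠ 0) :
    E.wt (β - α) ≠ ⊥ ∨ E.wt (β + α) ≠ ⊥ := by
  by_contra! h
  have hα0 : α ≠ 0 := by
    rintro rfl
    rw [E.form_H_nondeg t ht, map_zero] at hne
    exact hne rfl
  obtain ⟨i, ε, c, -, hc, x, hx, y, hy, hxy⟩ := E.exists_root_vectors hα hα0 ht
  obtain ⟨v, hv, hv0⟩ := Submodule.exists_mem_ne_zero_of_ne_bot hβ
  have hxv := E.bracket_mem_wt hx hv
  have hyv := E.bracket_mem_wt hy hv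
  rw [add_comm, h.2, Submodule.mem_bot] at hxv
  rw [neg_add_eq_sub, h.1, Submodule.mem_bot] at hyv
  have := hxy β v hv
  rw [hxv, hyv, map_zero, map_zero, smul_zero, sub_zero, eq_comm, smul_eq_zero_iff_left hv0] at this
  exact mul_ne_zero hc hne this

end EALS

/-- the root system `R` of an extended affine Lie superalgebra, inside the
subgroup `A` of `h*` it generates with the form `(α,β) := (t_α, t_β)`, is an extended
affine root supersystem: `(S1)` `0 ∈ R` (and `R` generates `A`, which holds by definition
of `A` as the subgroup generated by `R`), `(S2)` `R = -R`, `(S3)` integrality, `(S4)` the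
root string property, and `(S5)` the condition on nonsingular roots. -/
theorem EALS_root_system_is_EARS
    {F : Type} [Field F] [CharZero F] {L : Type} [AddCommGroup L] [Module F L]
    (E : EALS F L) :
    ((0 : Module.Dual F ↥E.H) ∈ {α : Module.Dual F ↥E.H | E.wt α ≠ ⊥} ∧
      AddSubgroup.closure {α : Module.Dual F ↥E.H | E.wt α ≠ ⊥}
        = AddSubgroup.closure {α : Module.Dual F ↥E.H | E.wt α ≠ ⊥}) ∧
    (∀ α : Module.Dual F ↥E.H, E.wt α ≠ ⊥ ↔ E.wt (-α) ≠ ⊥) ∧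
    (∀ α β : Module.Dual F ↥E.H, E.wt α ≠ ⊥ → E.wt β ≠ ⊥ →
      ∀ tα tβ : ↥E.H, (∀ s : ↥E.H, E.form ↑tα ↑s = α s) →
        (∀ s : ↥E.H, E.form ↑tβ ↑s = β s) → E.form ↑tα ↑tα ≠ 0 →
        ∃ n : ℤ, 2 * E.form ↑tα ↑tβ = (n : F) * E.form ↑tα ↑tα) ∧
    (∀ α β : Module.Dual F ↥E.H, E.wt α ≠ ⊥ → E.wt β ≠ ⊥ →
      ∀ tα tβ : ↥E.H, (∀ s : ↥E.H, E.form ↑tα ↑s = α s) →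
        (∀ s : ↥E.H, E.form ↑tβ ↑s = β s) → E.form ↑tα ↑tα ≠ 0 →
        ∃ p q : ℕ, 2 * E.form ↑tβ ↑tα = ((p : F) - (q : F)) * E.form ↑tα ↑tα ∧
          ∀ k : ℤ, E.wt (β + k • α) ≠ ⊥ ↔ -(p : ℤ) ≤ k ∧ k ≤ (q : ℤ)) ∧
    (∀ α β : Module.Dual F ↥E.H, E.wt α ≠ ⊥ → E.wt β ≠ ⊥ →
      ∀ tα tβ : ↥E.H, (∀ s : ↥E.H, E.form ↑tα ↑s = α s) →
        (∀ s : ↥E.H, E.form ↑tβ ↑s = β s) →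
        E.form ↑tα ↑tα = 0 → E.form ↑tα ↑tβ ≠ 0 →
        E.wt (β - α) ≠ ⊥ ∨ E.wt (β + α) ≠ ⊥) := by
  have symm : ∀ s t : E.H, E.form s t = E.form t s := fun s t => by
    simpa using E.form_super 0 0 s (E.H_le s.2) t (E.H_le t.2)
  refine ⟨⟨E.wt_zero_ne_bot, rfl⟩, fun α => ⟨E.wt_neg_ne_bot, fun h => ?_⟩,
    fun α β hα hβ t s ht hs hne => ?_, fun α β hα hβ t s ht hs hne => ?_,
    fun α β hα hβ t s ht hs _ hne => ?_⟩
  · simpa using E.wt_neg_ne_bot h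
  · rw [ht] at hne
    rw [symm t s, hs, ht]
    exact E.exists_int_two_mul_eq hα hβ ht hne
  · rw [ht] at hne
    rw [hs, ht]
    exact E.exists_string hα hβ ht hs (by rw [← ht, ← hs, symm]) hne
  · rw [symm, hs] at hne
    exact E.wt_sub_or_add_ne_bot hα hβ ht hne
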